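/- The ring R[T]/I_C is Cohen–Macaulay with Krull dimension d and HF(R[T]/I_C) = HF(k[D_σ]). Moreover, I_C is the initial ideal of I_G with respect to the reverse lexicographic order on R[T] with T > x_1 > … > x_n. -/

import Mathlib

open MvPolynomial

set_option synthInstance.maxHeartbeats 1000000
set_option maxHeartbeats 1000000

noncomputable section

namespace SRWLP

variable (k : Type) [Field k]

/-- An (abstract) simplicial complex on the vertex set `Fin n`:
a collection of finite subsets (faces) closed under passing to subsets. -/
structure SC (n : ℕ) where
  faces : Finset (Finset (Fin n))
  down_closed : ∀ s ∈ faces, ∀ t ⊆ s, t ∈ faces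

variable {n : ℕ}

/-- `dimP D = dim D + 1`, i.e. the maximal cardinality of a face of `D`. -/
def dimP (D : SC n) : ℕ := D.faces.sup Finset.card

/-- The Stanley–Reisner ideal of `D`: the ideal generated by the squarefree
monomials corresponding to non-faces. -/
def srIdeal (D : SC n) : Ideal (MvPolynomial (Fin n) k) :=
  Ideal.span { p | ∃ s : Finset (Fin n), s ∉ D.faces ∧ p = ∏ i ∈ s, X i }

/-- `x_σ`, the product of the variables indexed by the face `σ`. -/
def xFace (σ : Finset (Fin n)) : MvPolynomial (Fin n) k := ∏ i ∈ σ, X i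

variable {ι : Type} [Fintype ι]

/-- The degree-`m` graded component of the standard graded algebra
`k[Xᵢ : i ∈ ι] ⧸ J`, as a `k`-submodule. -/
def qComp (J : Ideal (MvPolynomial ι k)) (m : ℕ) :
    Submodule k (MvPolynomial ι k ⧸ J) :=
  (homogeneousSubmodule ι k m).map (Ideal.Quotient.mkₐ k J).toLinearMap

/-- Graded components indexed by `ℤ` (zero in negative degrees). -/
def qCompZ (J : Ideal (MvPolynomial ι k)) (m : ℤ) :
    Submodule k (MvPolynomial ι k ⧸ J) :=
  if 0 ≤ m then qComp k J m.toNat else ⊥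

/-- The Hilbert function of `k[Xᵢ] ⧸ J`. -/
def HFq (J : Ideal (MvPolynomial ι k)) (m : ℕ) : ℕ := Module.finrank k (qComp k J m)

/-- The Hilbert function, with `ℤ` argument. -/
def HFZ (J : Ideal (MvPolynomial ι k)) (m : ℤ) : ℕ := Module.finrank k (qCompZ k J m)

/-- A property `P` of tuples `c : τ → k` holds *generically* (i.e. for all choices
in a suitable nonempty Zariski-open subset of the affine space `k^τ`) if there is a
nonzero polynomial `g` such that `P c` holds whenever `g` does not vanish at `c`. -/
def Generic (τ : Type) (P : (τ → k) → Prop) : Prop :=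
  ∃ g : MvPolynomial τ k, g ≠ 0 ∧ ∀ c : τ → k, eval c g ≠ 0 → P c

/-- The linear form with coefficient tuple `c`. -/
def linForm (c : ι → k) : MvPolynomial ι k := ∑ i, C (c i) * X i

/-- The ideal `J` together with the `d` linear forms encoded by `c`. -/
def redIdeal (J : Ideal (MvPolynomial ι k)) {d : ℕ} (c : Fin d × ι → k) :
    Ideal (MvPolynomial ι k) :=
  J ⊔ Ideal.span (Set.range fun j : Fin d => linForm k fun i => c (j, i))

/-- `depth (k[Xᵢ]⧸J) ≥ t` : there is a regular sequence of length `t` consisting of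
elements of the graded maximal ideal. -/
def depthGE (J : Ideal (MvPolynomial ι k)) (t : ℕ) : Prop :=
  ∃ rs : List (MvPolynomial ι k), rs.length = t ∧
    (∀ f ∈ rs, f ∈ Ideal.span (Set.range (X : ι → MvPolynomial ι k))) ∧
    RingTheory.Sequence.IsRegular (MvPolynomial ι k ⧸ J)
      (rs.map (Ideal.Quotient.mk J))

/-- `k[Xᵢ]⧸J` is Cohen–Macaulay of Krull dimension `d`. -/
def isCM (J : Ideal (MvPolynomial ι k)) (d : ℕ) : Prop :=
  ringKrullDim (MvPolynomial ι k ⧸ J) = (d : ℕ) ∧ depthGE k J d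

/-- The socle of `k[Xᵢ]⧸J` (the annihilator of the graded maximal ideal). -/
def socle (J : Ideal (MvPolynomial ι k)) : Submodule k (MvPolynomial ι k ⧸ J) :=
  ⨅ i : ι, LinearMap.ker (LinearMap.mulLeft k (Ideal.Quotient.mk J (X i)))

/-- `k[Xᵢ]⧸J` is Artinian Gorenstein: Artinian with one-dimensional socle. -/
def artGor (J : Ideal (MvPolynomial ι k)) : Prop :=
  IsArtinianRing (MvPolynomial ι k ⧸ J) ∧ Module.finrank k (socle k J) = 1

/-- `k[Xᵢ]⧸J` is Gorenstein of Krull dimension `d`: it is Cohen–Macaulay of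
dimension `d` and a general Artinian reduction is Artinian Gorenstein. -/
def isGor (J : Ideal (MvPolynomial ι k)) (d : ℕ) : Prop :=
  isCM k J d ∧ Generic k (Fin d × ι) fun c => artGor k (redIdeal k J c)

/-- Multiplication by `ω` from the degree-`m` component to the degree-`(m+1)`
component of `k[Xᵢ]⧸J` has maximal rank (is injective or surjective). -/
def mulMaxRank (J : Ideal (MvPolynomial ι k)) (ω : MvPolynomial ι k ⧸ J) (m : ℕ) : Prop :=
  (∀ x ∈ qComp k J m, ω * x = 0 → x = 0) ∨
  (∀ y ∈ qComp k J (m + 1), ∃ x ∈ qComp k J m, ω * x = y)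

/-- The Weak Lefschetz Property for the Artinian algebra `k[Xᵢ]⧸J`: for a general
linear form `ω`, multiplication `ω : (⧸J)ₘ → (⧸J)ₘ₊₁` has maximal rank for all `m`. -/
def artWLP (J : Ideal (MvPolynomial ι k)) : Prop :=
  Generic k ι fun c => ∀ m : ℕ,
    mulMaxRank k J (Ideal.Quotient.mk J (linForm k c)) m

/-- The Weak Lefschetz Property for `k[Xᵢ]⧸J` of Krull dimension `d ≥ 1`:
Cohen–Macaulay, and a general Artinian reduction has the WLP. -/
def hasWLP (J : Ideal (MvPolynomial ι k)) (d : ℕ) : Prop :=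
  isCM k J d ∧ Generic k (Fin d × ι) fun c => artWLP k (redIdeal k J c)

/-- The Strong Lefschetz Property for the Artinian algebra `k[Xᵢ]⧸J`. -/
def artSLP (J : Ideal (MvPolynomial ι k)) : Prop :=
  ∃ r : ℕ, qComp k J r ≠ ⊥ ∧ (∀ j : ℕ, r < j → qComp k J j = ⊥) ∧
    (∀ i ≤ r, HFq k J i = HFq k J (r - i)) ∧
    Generic k ι fun c => ∀ i : ℕ, 2 * i ≤ r →
      (∀ x ∈ qComp k J i,
          Ideal.Quotient.mk J (linForm k c) ^ (r - 2 * i) * x = 0 → x = 0) ∧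
      (∀ y ∈ qComp k J (r - i), ∃ x ∈ qComp k J i,
          Ideal.Quotient.mk J (linForm k c) ^ (r - 2 * i) * x = y)

/-- The Strong Lefschetz Property for `k[Xᵢ]⧸J` of Krull dimension `d ≥ 1`. -/
def hasSLP (J : Ideal (MvPolynomial ι k)) (d : ℕ) : Prop :=
  isCM k J d ∧ Generic k (Fin d × ι) fun c => artSLP k (redIdeal k J c)

/-- `D` is Gorenstein* over `k`: every element of the vertex set is a vertex,
`k[D]` is Gorenstein (of dimension `dim D + 1`), and for every vertex `i` there is a
face `τ` with `τ ∪ {i}` not a face. -/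
def gorStar (D : SC n) : Prop :=
  (∀ i : Fin n, {i} ∈ D.faces) ∧
  isGor k (srIdeal k D) (dimP D) ∧
  (∀ i : Fin n, ∃ τ ∈ D.faces, insert i τ ∉ D.faces)

/-! `R[T]` is modelled as the polynomial ring in `n+1` variables, the last
variable playing the role of `T`. -/

/-- The inclusion `R = k[x₁,…,xₙ] → R[T] = k[x₁,…,xₙ,T]`. -/
def toT : MvPolynomial (Fin n) k →ₐ[k] MvPolynomial (Fin (n + 1)) k :=
  rename Fin.castSucc

/-- The variable `T` of `R[T]`. -/
def Tv (n : ℕ) : MvPolynomial (Fin (n + 1)) k := X (Fin.last n)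

/-- Extension of an ideal of `R` to `R[T]`. -/
def extI (J : Ideal (MvPolynomial (Fin n) k)) : Ideal (MvPolynomial (Fin (n + 1)) k) :=
  Ideal.map (toT k) J

/-- The ideal `T·J` of `R[T]`, for an ideal `J` of `R`. -/
def TmulI (J : Ideal (MvPolynomial (Fin n) k)) : Ideal (MvPolynomial (Fin (n + 1)) k) :=
  Ideal.span ((fun f => Tv k n * toT k f) '' (J : Set (MvPolynomial (Fin n) k)))

/-- `I_L = (I_D : x_σ)`, the Stanley–Reisner ideal of the link of `σ` in `D`
(extended to `R`). -/
def linkIdeal (D : SC n) (σ : Finset (Fin n)) : Ideal (MvPolynomial (Fin n) k) :=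
  Submodule.colon (srIdeal k D) (Ideal.span {xFace k σ})

/-- `J_st = (I, x_σ, T·I_L) ⊂ R[T]`, the Stanley–Reisner ideal of the stellar
subdivision `D_σ`. -/
def Jst (D : SC n) (σ : Finset (Fin n)) : Ideal (MvPolynomial (Fin (n + 1)) k) :=
  extI k (srIdeal k D) ⊔ Ideal.span {toT k (xFace k σ)} ⊔ TmulI k (linkIdeal k D σ)

/-- `I_C = (I, T^{q+1}, T·I_L) ⊂ R[T]`. -/
def IC (D : SC n) (σ : Finset (Fin n)) (q : ℕ) : Ideal (MvPolynomial (Fin (n + 1)) k) :=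
  extI k (srIdeal k D) ⊔ Ideal.span {Tv k n ^ (q + 1)} ⊔ TmulI k (linkIdeal k D σ)

/-- `I_G = (I, T^{q+1} - x_σ, T·I_L) ⊂ R[T]`. -/
def IG (D : SC n) (σ : Finset (Fin n)) (q : ℕ) : Ideal (MvPolynomial (Fin (n + 1)) k) :=
  extI k (srIdeal k D) ⊔ Ideal.span {Tv k n ^ (q + 1) - toT k (xFace k σ)} ⊔
    TmulI k (linkIdeal k D σ)

/-- The ideal of `R[T]` generated by `d` general linear forms of `R`
(involving only the `x`-variables). -/
def xForms {d : ℕ} (c : Fin d × Fin n → k) : Ideal (MvPolynomial (Fin (n + 1)) k) :=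
  Ideal.span (Set.range fun j : Fin d => toT k (linForm k fun i => c (j, i)))

/-- Property `M_{q,p₁}` for the Artinian algebra `B = R⧸J_B`: for a general linear
form `ω`, multiplication by `ω^q : B_{p₁-q} → B_{p₁}` is injective. -/
def propM (JB : Ideal (MvPolynomial (Fin n) k)) (q p₁ : ℕ) : Prop :=
  Generic k (Fin n) fun c => ∀ x ∈ qCompZ k JB ((p₁ : ℤ) - (q : ℤ)),
    Ideal.Quotient.mk JB (linForm k c) ^ q * x = 0 → x = 0


/-- The enumeration of the variables of `R[T] = k[x₁,…,xₙ,T]` (with `T` the last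
variable, and variable significance `T > x₁ > … > xₙ`) starting from the least
significant one: `xₙ, xₙ₋₁, …, x₁, T`. -/
def revEnum (n : ℕ) (j : Fin (n + 1)) : Fin (n + 1) :=
  if h : (j : ℕ) < n then ⟨n - 1 - (j : ℕ), by omega⟩ else ⟨n, by omega⟩

/-- Total degree of an exponent vector. -/
def expDeg {n : ℕ} (μ : Fin (n + 1) →₀ ℕ) : ℕ := μ.sum fun _ e => e

/-- `μ` is smaller than `ν` in the (degree) reverse lexicographic order on `R[T]`
with `T > x₁ > … > xₙ`. -/
def revLexLT {n : ℕ} (μ ν : Fin (n + 1) →₀ ℕ) : Prop :=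
  expDeg μ < expDeg ν ∨
    (expDeg μ = expDeg ν ∧ ∃ j : Fin (n + 1),
      ν (revEnum n j) < μ (revEnum n j) ∧
      ∀ i : Fin (n + 1), i < j → μ (revEnum n i) = ν (revEnum n i))

/-- The initial ideal of `J ⊂ R[T]` with respect to the reverse lexicographic
order with `T > x₁ > … > xₙ`: the ideal generated by the leading monomials of the
nonzero elements of `J`. -/
def initIdeal (J : Ideal (MvPolynomial (Fin (n + 1)) k)) :
    Ideal (MvPolynomial (Fin (n + 1)) k) :=
  Ideal.span { p | ∃ f ∈ J, ∃ μ ∈ f.support, p = monomial μ (1 : k) ∧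
    ∀ ν ∈ f.support, ν ≠ μ → revLexLT ν μ }

/-! ### Regular sequences on cyclic modules -/

/-- `rs` is a weakly regular sequence on `R ⧸ J`, expressed through ideals of `R`. -/
def RegOn {R : Type*} [CommRing R] : Ideal R → List R → Prop
  | _, [] => True
  | J, f :: rs => (∀ z, f * z ∈ J → z ∈ J) ∧ RegOn (J ⊔ Ideal.span {f}) rs

/-- `R ⧸ J` admits a weakly regular sequence of length `t` in `m`. -/
def HasReg {R : Type*} [CommRing R] (m J : Ideal R) (t : ℕ) : Prop :=
  ∃ rs : List R, rs.length = t ∧ (∀ f ∈ rs, f ∈ m) ∧ RegOn J rs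

lemma hasReg_zero {R : Type*} [CommRing R] (m J : Ideal R) : HasReg m J 0 :=
  ⟨[], rfl, by simp, trivial⟩

lemma hasReg_succ_iff {R : Type*} [CommRing R] {m J : Ideal R} {t : ℕ} :
    HasReg m J (t + 1) ↔
      ∃ f ∈ m, (∀ z, f * z ∈ J → z ∈ J) ∧ HasReg m (J ⊔ Ideal.span {f}) t := by
  constructor
  · rintro ⟨_ | ⟨f, rs⟩, hl, hm, hr⟩
    · simp at hl
    · exact ⟨f, hm f (by simp), hr.1, rs, by simpa using hl,
        fun g hg => hm g (by simp [hg]), hr.2⟩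
  · rintro ⟨f, hf, hz, rs, hl, hm, hr⟩
    exact ⟨f :: rs, by simp [hl], by simpa using ⟨hf, hm⟩, hz, hr⟩

lemma regOn_iff {R : Type*} [CommRing R] (rs : List R) (J : Ideal R) :
    RegOn J rs ↔ ∀ (i : ℕ) (h : i < rs.length) (z : R),
      rs[i] * z ∈ J ⊔ Ideal.ofList (rs.take i) → z ∈ J ⊔ Ideal.ofList (rs.take i) := by
  induction rs generalizing J with
  | nil => simp [RegOn]
  | cons f rs ih =>
    rw [RegOn, ih]
    constructor
    · rintro ⟨h0, h⟩ (_ | i) hi z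
      · simpa using h0 z
      · simpa [← sup_assoc] using h i (by simpa using hi) z
    · intro h
      refine ⟨fun z => by simpa using h 0 (Nat.succ_pos _) z, fun i hi z => ?_⟩
      simpa [← sup_assoc] using h (i + 1) (Nat.succ_lt_succ hi) z

lemma isWeaklyRegular_map_mk_iff {R : Type*} [CommRing R] (J : Ideal R) (rs : List R) :
    RingTheory.Sequence.IsWeaklyRegular (R ⧸ J) (rs.map (Ideal.Quotient.mk J)) ↔
      RegOn J rs := by
  have key (l : List R) (z : R) : Ideal.Quotient.mk J z ∈
      (Ideal.ofList (l.map (Ideal.Quotient.mk J)) • ⊤ : Submodule (R ⧸ J) (R ⧸ J)) ↔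
      z ∈ J ⊔ Ideal.ofList l := by
    rw [smul_eq_mul, Ideal.mul_top, ← Ideal.map_ofList, sup_comm,
      ← Ideal.mem_quotient_iff_mem_sup]
  rw [regOn_iff, RingTheory.Sequence.isWeaklyRegular_iff]
  refine forall_congr' fun i => ?_
  simp only [List.length_map, List.getElem_map]
  refine forall_congr' fun hi => ?_
  rw [isSMulRegular_quotient_iff_mem_of_smul_mem, ← List.map_take,
    Ideal.Quotient.mk_surjective.forall]
  refine forall_congr' fun z => ?_
  rw [← key, ← key, map_mul]
  rfl

/-- Prime avoidance, pulled back along a ring homomorphism: if no nonzero element of any of the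
`R ⧸ J`, `J ∈ s`, is killed by `φ(m)`, then some `φ h` with `h ∈ m` is regular on all of them. -/
lemma exists_mem_regular {A R : Type*} [CommRing A] [CommRing R] [IsNoetherianRing R]
    (φ : A →+* R) (m : Ideal A) (s : List (Ideal R))
    (hs : ∀ J ∈ s, ∀ z, (∀ a ∈ m, φ a * z ∈ J) → z ∈ J) :
    ∃ h ∈ m, ∀ J ∈ s, ∀ z, φ h * z ∈ J → z ∈ J := by
  classical
  have hfin : (⋃ J ∈ {J | J ∈ s}, associatedPrimes R (R ⧸ J)).Finite :=
    (List.finite_toSet s).biUnion fun J _ => associatedPrimes.finite R (R ⧸ J)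
  set T := hfin.toFinset with hT
  have hmem : ∀ P, P ∈ T ↔ ∃ J ∈ s, P ∈ associatedPrimes R (R ⧸ J) := by
    intro P; simp [hT]
  by_contra! hcon
  have hsub : (m : Set A) ⊆ ⋃ P ∈ (T : Set (Ideal R)), (P.comap φ : Ideal A) := by
    intro h hh
    obtain ⟨J, hJ, z, hz, hzJ⟩ := hcon h hh
    have h1 : φ h ∈ ⋃ P ∈ associatedPrimes R (R ⧸ J), (P : Set R) := by
      rw [biUnion_associatedPrimes_eq_compl_regular]
      intro hreg
      exact hzJ ((isSMulRegular_quotient_iff_mem_of_smul_mem J (φ h)).1 hreg z hz)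
    simp only [Set.mem_iUnion] at h1 ⊢
    obtain ⟨P, hP, hhP⟩ := h1
    exact ⟨P, (hmem P).2 ⟨J, hJ, hP⟩, hhP⟩
  rw [Ideal.subset_union_prime ⊤ ⊤] at hsub
  · obtain ⟨P, hP, hmP⟩ := hsub
    obtain ⟨J, hJ, hPJ⟩ := (hmem P).1 hP
    obtain ⟨hprime, x, rfl⟩ := isAssociatedPrime_iff.1 hPJ
    obtain ⟨x, rfl⟩ := Ideal.Quotient.mk_surjective x
    have hx (a : R) : a ∈ Submodule.colon ⊥ {Ideal.Quotient.mk J x} ↔ a * x ∈ J := by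
      rw [Submodule.mem_colon_singleton, Submodule.mem_bot, ← Ideal.Quotient.eq_zero_iff_mem,
        map_mul]
      rfl
    refine hprime.ne_top ((Ideal.eq_top_iff_one _).2 ((hx 1).2 ?_))
    rw [one_mul]
    exact hs J hJ x fun a ha => (hx _).1 (hmP ha)
  · intro P hP _ _
    obtain ⟨J, hJ, hPJ⟩ := (hmem P).1 hP
    have := hPJ.isPrime
    infer_instance

/-- Two regular elements are interchangeable as first elements of regular sequences. -/
lemma HasReg.exchange {R : Type*} [CommRing R] [IsNoetherianRing R] {m : Ideal R} (t : ℕ) :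
    ∀ (J : Ideal R) (f g : R), f ∈ m → g ∈ m → (∀ z, f * z ∈ J → z ∈ J) →
      (∀ z, g * z ∈ J → z ∈ J) → HasReg m (J ⊔ Ideal.span {f}) t →
      HasReg m (J ⊔ Ideal.span {g}) t := by
  have mem_sup (J : Ideal R) (f z : R) : z ∈ J ⊔ Ideal.span {f} ↔ ∃ w, z - f * w ∈ J := by
    rw [sup_comm, Ideal.mem_span_singleton_sup]
    constructor
    · rintro ⟨a, b, hb, rfl⟩; exact ⟨a, by convert hb using 1; ring⟩
    · rintro ⟨w, hw⟩; exact ⟨w, _, hw, by ring⟩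
  have swap (J : Ideal R) (f h : R) (hf : ∀ z, f * z ∈ J → z ∈ J)
      (hh : ∀ z, h * z ∈ J ⊔ Ideal.span {f} → z ∈ J ⊔ Ideal.span {f}) (z : R)
      (hz : f * z ∈ J ⊔ Ideal.span {h}) : z ∈ J ⊔ Ideal.span {h} := by
    obtain ⟨w, hw⟩ := (mem_sup _ _ _).1 hz
    obtain ⟨v, hv⟩ := (mem_sup _ _ _).1
      (hh w ((mem_sup _ _ _).2 ⟨z, by convert J.neg_mem hw using 1; ring⟩))
    refine (mem_sup _ _ _).2 ⟨v, hf _ ?_⟩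
    convert J.add_mem hw (J.mul_mem_left h hv) using 1; ring
  induction t with
  | zero => exact fun J f g _ _ _ _ _ => hasReg_zero _ _
  | succ t ih =>
    intro J f g hfm hgm hf hg hreg
    obtain ⟨h₀, hh₀m, hh₀, hreg₀⟩ := hasReg_succ_iff.1 hreg
    obtain ⟨h, hhm, hh⟩ := exists_mem_regular (RingHom.id R) m
        [J, J ⊔ Ideal.span {f}, J ⊔ Ideal.span {g}] (by
      simp only [List.mem_cons, List.not_mem_nil, or_false, forall_eq_or_imp, forall_eq,
        RingHom.id_apply]
      refine ⟨fun z hz => hf z (hz f hfm), fun z hz => hh₀ z (hz h₀ hh₀m), fun z hz => ?_⟩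
      obtain ⟨w, hw⟩ := (mem_sup _ _ _).1 (hz f hfm)
      have hmw : h₀ * w ∈ J ⊔ Ideal.span {f} := by
        obtain ⟨u, hu⟩ := (mem_sup _ _ _).1 (hz h₀ hh₀m)
        refine (mem_sup _ _ _).2 ⟨u, hg _ ?_⟩
        convert J.sub_mem (J.mul_mem_left f hu) (J.mul_mem_left h₀ hw) using 1; ring
      obtain ⟨v, hv⟩ := (mem_sup _ _ _).1 (hh₀ w hmw)
      refine (mem_sup _ _ _).2 ⟨v, hf _ ?_⟩
      convert J.add_mem hw (J.mul_mem_left g hv) using 1; ring)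
    simp only [List.mem_cons, List.not_mem_nil, or_false, forall_eq_or_imp, forall_eq,
        RingHom.id_apply] at hh
    obtain ⟨hJ, hJf, hJg⟩ := hh
    refine hasReg_succ_iff.2 ⟨h, hhm, hJg, ?_⟩
    have h1 := ih _ _ _ hh₀m hhm hh₀ hJf hreg₀
    rw [sup_right_comm] at h1 ⊢
    exact ih _ _ _ hfm hgm (swap J f h hf hJf) (swap J g h hg hJg) h1

/-- Depth does not change when only elements coming from a subring are allowed, as long as the
ideals have the same radical. -/
lemma HasReg.exists_map {A R : Type*} [CommRing A] [CommRing R] [IsNoetherianRing R]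
    (φ : A →+* R) {m' : Ideal A} {m : Ideal R} (h₁ : m'.map φ ≤ m) (h₂ : m ≤ (m'.map φ).radical)
    (t : ℕ) (J : Ideal R) (h : HasReg m J t) :
    ∃ gs : List A, gs.length = t ∧ (∀ g ∈ gs, g ∈ m') ∧ RegOn J (gs.map φ) := by
  induction t generalizing J with
  | zero => exact ⟨[], rfl, by simp, trivial⟩
  | succ t ih =>
    obtain ⟨f, hfm, hf, hreg⟩ := hasReg_succ_iff.1 h
    obtain ⟨g, hgm, hg⟩ := exists_mem_regular φ m' [J] (by
      simp only [List.mem_singleton, forall_eq]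
      intro z hz
      obtain ⟨N, hN⟩ := h₂ hfm
      have h3 : f ^ N * z ∈ J := by
        have : m'.map φ ≤ Submodule.colon J {z} := by
          rw [Ideal.map_le_iff_le_comap]
          intro a ha
          simpa [Submodule.mem_colon_singleton] using hz a ha
        simpa [Submodule.mem_colon_singleton] using this hN
      clear hN
      induction N with
      | zero => simpa using h3
      | succ N ihN => exact ihN (hf _ (by rwa [← mul_assoc, ← pow_succ'])))
    simp only [List.mem_singleton, forall_eq] at hg
    obtain ⟨gs, hl, hgs, hr⟩ := ih _ (HasReg.exchange t J f (φ g) hfm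
      (h₁ (Ideal.mem_map_of_mem φ hgm)) hf hg hreg)
    exact ⟨g :: gs, by simp [hl], by simpa using ⟨hgm, hgs⟩, by simpa [RegOn] using ⟨hg, hr⟩⟩

/-- Regular sequences descend to retracts. -/
lemma RegOn.of_retract {A R S : Type*} [CommRing A] [CommRing R] [CommRing S]
    (a : A →+* S) (b : A →+* R) (i : S →+ R) (r : R →+ S)
    (hi : ∀ g z, i (a g * z) = b g * i z) (hr : ∀ g y, r (b g * y) = a g * r y)
    (gs : List A) : ∀ (J : Ideal S) (K : Ideal R), (∀ z ∈ J, i z ∈ K) → (∀ y ∈ K, r y ∈ J) →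
      (∀ z, r (i z) - z ∈ J) → RegOn K (gs.map b) → RegOn J (gs.map a) := by
  induction gs with
  | nil => intros; trivial
  | cons g gs ih =>
    rintro J K hiJ hrK hri ⟨h0, h⟩
    refine ⟨fun z hz => ?_, ih _ _ ?_ ?_ ?_ h⟩
    · have := hrK _ (h0 (i z) (by rw [← hi]; exact hiJ _ hz))
      simpa using J.sub_mem this (hri z)
    · intro z hz
      rw [sup_comm, Ideal.mem_span_singleton_sup] at hz ⊢
      obtain ⟨u, v, hv, rfl⟩ := hz
      exact ⟨i u, i v, hiJ v hv, by rw [map_add, mul_comm u, hi]; ring⟩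
    · intro z hz
      rw [sup_comm, Ideal.mem_span_singleton_sup] at hz ⊢
      obtain ⟨u, v, hv, rfl⟩ := hz
      exact ⟨r u, r v, hrK v hv, by rw [map_add, mul_comm u, hr]; ring⟩
    · exact fun z => Ideal.mem_sup_left (hri z)

/-! ### Monomial ideals -/

/-- The monomial ideal attached to an upward closed set of exponents. -/
def monIdeal {ι : Type} (P : (ι →₀ ℕ) → Prop) (hP : ∀ a b, P b → P (a + b)) :
    Ideal (MvPolynomial ι k) where
  carrier := {f | ∀ μ, ¬ P μ → coeff μ f = 0}
  zero_mem' := by simp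
  add_mem' {f g} hf hg μ hμ := by rw [coeff_add, hf μ hμ, hg μ hμ, add_zero]
  smul_mem' c f hf μ hμ := by
    classical
    rw [smul_eq_mul, coeff_mul]
    refine Finset.sum_eq_zero fun x hx => ?_
    rw [hf x.2 fun h => hμ ?_, mul_zero]
    rw [← Finset.HasAntidiagonal.mem_antidiagonal.1 hx]
    exact hP _ _ h

section MonomialIdeals

variable {k} {ι : Type} {P : (ι →₀ ℕ) → Prop} {hP : ∀ a b, P b → P (a + b)}

lemma mem_monIdeal {f : MvPolynomial ι k} :
    f ∈ monIdeal k P hP ↔ ∀ μ, ¬ P μ → coeff μ f = 0 := Iff.rfl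

lemma monomial_mem_monIdeal {μ : ι →₀ ℕ} : monomial μ (1 : k) ∈ monIdeal k P hP ↔ P μ := by
  classical
  rw [mem_monIdeal]
  constructor
  · intro h
    by_contra hμ
    simpa using h μ hμ
  · intro h ν hν
    rw [coeff_monomial, if_neg]
    rintro rfl
    exact hν h

lemma mem_of_monomials {K : Ideal (MvPolynomial ι k)} {f : MvPolynomial ι k}
    (h : ∀ μ ∈ f.support, monomial μ (1 : k) ∈ K) : f ∈ K := by
  rw [f.as_sum]
  refine Ideal.sum_mem _ fun μ hμ => ?_
  rw [← mul_one (coeff μ f), ← C_mul_monomial]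
  exact K.mul_mem_left _ (h μ hμ)

lemma monIdeal_le {K : Ideal (MvPolynomial ι k)} (h : ∀ μ, P μ → monomial μ (1 : k) ∈ K) :
    monIdeal k P hP ≤ K := fun f hf => mem_of_monomials fun μ hμ =>
  h μ (by by_contra hc; exact (mem_support_iff.1 hμ) (hf μ hc))

/-- The Hilbert function of a monomial ideal counts the standard monomials. -/
lemma HFq_monIdeal [Fintype ι] (m : ℕ) :
    HFq k (monIdeal k P hP) m = Nat.card {μ : ι →₀ ℕ // μ.degree = m ∧ ¬ P μ} := by
  classical
  set J := monIdeal k P hP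
  let v : {μ : ι →₀ ℕ // μ.degree = m ∧ ¬ P μ} → MvPolynomial ι k ⧸ J :=
    fun μ => Ideal.Quotient.mkₐ k J (monomial μ.1 1)
  have hspan : qComp k J m = Submodule.span k (Set.range v) := by
    apply le_antisymm
    · rintro _ ⟨f, hf, rfl⟩
      change Ideal.Quotient.mkₐ k J f ∈ _
      rw [f.as_sum, map_sum]
      refine Submodule.sum_mem _ fun μ hμ => ?_
      rw [← mul_one (coeff μ f), ← smul_eq_mul, ← smul_monomial, map_smul]
      refine Submodule.smul_mem _ _ ?_
      by_cases hPμ : P μ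
      · have : Ideal.Quotient.mkₐ k J (monomial μ 1) = 0 :=
          Ideal.Quotient.eq_zero_iff_mem.2 (monomial_mem_monIdeal.2 hPμ)
        rw [this]
        exact Submodule.zero_mem _
      · refine Submodule.subset_span ⟨⟨μ, ?_, hPμ⟩, rfl⟩
        rw [Finsupp.degree_eq_weight_one]
        exact hf (mem_support_iff.1 hμ)
    · rw [Submodule.span_le]
      rintro _ ⟨⟨μ, hμ, hPμ⟩, rfl⟩
      exact ⟨_, isHomogeneous_monomial 1 hμ, rfl⟩
  have hli : LinearIndependent k v := by
    rw [linearIndependent_iff']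
    intro s g hg μ hμ
    have h1 : (∑ i ∈ s, monomial i.1 (g i) : MvPolynomial ι k) ∈ J := by
      rw [← Ideal.Quotient.eq_zero_iff_mem]
      change Ideal.Quotient.mkₐ k J _ = 0
      rw [← hg, map_sum]
      refine Finset.sum_congr rfl fun i _ => ?_
      rw [← map_smul, smul_monomial, smul_eq_mul, mul_one]
    have h2 := h1 μ.1 μ.2.2
    rw [coeff_sum, Finset.sum_eq_single μ] at h2
    · simpa using h2
    · intro i _ hi
      rw [coeff_monomial, if_neg fun h => hi (Subtype.ext h)]
    · exact fun h => absurd hμ h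
  rw [HFq, hspan]
  exact Module.finrank_eq_nat_card_basis (Module.Basis.span hli)

end MonomialIdeals

/-! ### Exponents of `R[T]` -/

/-- Exponents of `R` as exponents of `R[T]`. -/
def upExp {n : ℕ} (α : Fin n →₀ ℕ) : Fin (n + 1) →₀ ℕ := α.mapDomain Fin.castSucc

/-- The `R`-part of an exponent of `R[T]`. -/
def baseExp {n : ℕ} (μ : Fin (n + 1) →₀ ℕ) : Fin n →₀ ℕ :=
  Finsupp.equivFunOnFinite.symm fun i => μ i.castSucc

/-- The exponent of `x_σ`. -/
def indExp {n : ℕ} (σ : Finset (Fin n)) : Fin n →₀ ℕ :=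
  Finsupp.equivFunOnFinite.symm fun i => if i ∈ σ then 1 else 0

/-- The exponent of `T ^ t · x ^ α`. -/
def consExp {n : ℕ} (t : ℕ) (α : Fin n →₀ ℕ) : Fin (n + 1) →₀ ℕ :=
  Finsupp.single (Fin.last n) t + upExp α

section Exponents

variable {k} {n : ℕ}

@[simp] lemma upExp_castSucc (α : Fin n →₀ ℕ) (i : Fin n) : upExp α i.castSucc = α i :=
  Finsupp.mapDomain_apply (Fin.castSucc_injective n) _ _

@[simp] lemma upExp_last (α : Fin n →₀ ℕ) : upExp α (Fin.last n) = 0 :=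
  Finsupp.mapDomain_of_notMem_range _ _ (by rintro ⟨i, hi⟩; exact (Fin.castSucc_ne_last i) hi)

@[simp] lemma baseExp_apply (μ : Fin (n + 1) →₀ ℕ) (i : Fin n) : baseExp μ i = μ i.castSucc := rfl

@[simp] lemma indExp_apply (σ : Finset (Fin n)) (i : Fin n) :
    indExp σ i = if i ∈ σ then 1 else 0 := rfl

@[simp] lemma consExp_castSucc (t : ℕ) (α : Fin n →₀ ℕ) (i : Fin n) :
    consExp t α i.castSucc = α i := by
  simp [consExp]

@[simp] lemma consExp_last (t : ℕ) (α : Fin n →₀ ℕ) : consExp t α (Fin.last n) = t := by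
  simp [consExp]

lemma exp_ext {μ ν : Fin (n + 1) →₀ ℕ} (h : ∀ i : Fin n, μ i.castSucc = ν i.castSucc)
    (h' : μ (Fin.last n) = ν (Fin.last n)) : μ = ν :=
  Finsupp.ext fun i => Fin.lastCases h' h i

lemma consExp_baseExp (μ : Fin (n + 1) →₀ ℕ) : consExp (μ (Fin.last n)) (baseExp μ) = μ :=
  exp_ext (by simp) (by simp)

lemma baseExp_consExp (t : ℕ) (α : Fin n →₀ ℕ) : baseExp (consExp t α) = α := by
  ext; simp

lemma baseExp_add (μ ν : Fin (n + 1) →₀ ℕ) : baseExp (μ + ν) = baseExp μ + baseExp ν := by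
  ext; simp

lemma degree_consExp (t : ℕ) (α : Fin n →₀ ℕ) : (consExp t α).degree = t + α.degree := by
  simp [Finsupp.degree_eq_sum, Fin.sum_univ_castSucc, add_comm]

lemma degree_indExp (σ : Finset (Fin n)) : (indExp σ).degree = σ.card := by
  simp [Finsupp.degree_eq_sum]

lemma support_indExp (σ : Finset (Fin n)) : (indExp σ).support = σ := by
  ext; simp

lemma support_exp_add (α β : Fin n →₀ ℕ) : (α + β).support = α.support ∪ β.support := by
  ext i; simp; tauto

lemma prod_X_eq_monomial (s : Finset (Fin n)) :
    (∏ i ∈ s, X i : MvPolynomial (Fin n) k) = monomial (indExp s) 1 := by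
  classical
  have : indExp s = ∑ i ∈ s, Finsupp.single i 1 := by
    ext j; simp [Finsupp.finsetSum_apply, Finsupp.single_apply]
  rw [this, monomial_sum_one]
  rfl

lemma toT_monomial (α : Fin n →₀ ℕ) (c : k) : toT k (monomial α c) = monomial (upExp α) c :=
  rename_monomial _ _ _

lemma Tv_pow_mul_toT (t : ℕ) (α : Fin n →₀ ℕ) :
    Tv k n ^ t * toT k (monomial α 1) = monomial (consExp t α) 1 := by
  rw [toT_monomial, Tv, X_pow_eq_monomial, monomial_mul, one_mul, consExp]

lemma Tv_pow_eq_monomial (t : ℕ) : Tv k n ^ t = monomial (consExp t 0) 1 := by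
  rw [← Tv_pow_mul_toT]
  simp

end Exponents

/-! ### The ideals as monomial ideals -/

section Ideals

variable {k} {n q : ℕ} {D : SC n} {σ : Finset (Fin n)}

lemma SC.notMem_mono (D : SC n) {s t : Finset (Fin n)} (h : s ⊆ t) (hs : s ∉ D.faces) :
    t ∉ D.faces := fun ht => hs (D.down_closed t ht s h)

lemma support_subset_add (a b : Fin n →₀ ℕ) : b.support ⊆ (a + b).support := by
  rw [support_exp_add]; exact Finset.subset_union_right

/-- The exponents of the monomials of the Stanley–Reisner ideal. -/
def NonFace (D : SC n) (α : Fin n →₀ ℕ) : Prop := α.support ∉ D.faces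

lemma NonFace.add {D : SC n} (a b : Fin n →₀ ℕ) (h : NonFace D b) : NonFace D (a + b) :=
  D.notMem_mono (support_subset_add a b) h

/-- The exponents of the monomials of the ideal of the link. -/
def NonLink (D : SC n) (σ : Finset (Fin n)) (α : Fin n →₀ ℕ) : Prop :=
  α.support ∪ σ ∉ D.faces

lemma NonLink.add {D : SC n} {σ : Finset (Fin n)} (a b : Fin n →₀ ℕ) (h : NonLink D σ b) :
    NonLink D σ (a + b) :=
  D.notMem_mono (Finset.union_subset_union_left (support_subset_add a b)) h

/-- The exponents of the monomials of `I_C`. -/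
def NonC (D : SC n) (σ : Finset (Fin n)) (q : ℕ) (μ : Fin (n + 1) →₀ ℕ) : Prop :=
  NonFace D (baseExp μ) ∨ q < μ (Fin.last n) ∨
    (μ (Fin.last n) ≠ 0 ∧ NonLink D σ (baseExp μ))

lemma NonC.add (a b : Fin (n + 1) →₀ ℕ) (h : NonC D σ q b) : NonC D σ q (a + b) := by
  simp only [NonC, baseExp_add, Finsupp.add_apply] at h ⊢
  rcases h with h | h | ⟨h, h'⟩
  · exact .inl (h.add _ _)
  · exact .inr (.inl (by omega))
  · exact .inr (.inr ⟨by omega, h'.add _ _⟩)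

/-- The exponents of the monomials of the Stanley–Reisner ideal of the stellar subdivision. -/
def NonSt (D : SC n) (σ : Finset (Fin n)) (μ : Fin (n + 1) →₀ ℕ) : Prop :=
  NonFace D (baseExp μ) ∨ σ ⊆ (baseExp μ).support ∨
    (μ (Fin.last n) ≠ 0 ∧ NonLink D σ (baseExp μ))

lemma NonSt.add (a b : Fin (n + 1) →₀ ℕ) (h : NonSt D σ b) : NonSt D σ (a + b) := by
  simp only [NonSt, baseExp_add, Finsupp.add_apply] at h ⊢
  rcases h with h | h | ⟨h, h'⟩
  · exact .inl (h.add _ _)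
  · exact .inr (.inl (h.trans (support_subset_add _ _)))
  · exact .inr (.inr ⟨by omega, h'.add _ _⟩)

lemma srIdeal_eq : srIdeal k D = monIdeal k (NonFace D) NonFace.add := by
  apply le_antisymm
  · rw [srIdeal, Ideal.span_le]
    rintro _ ⟨s, hs, rfl⟩
    rw [prod_X_eq_monomial, SetLike.mem_coe, monomial_mem_monIdeal, NonFace, support_indExp]
    exact hs
  · refine monIdeal_le fun α hα => ?_
    have h : α - indExp α.support + indExp α.support = α := by
      ext i
      by_cases hi : α i = 0 <;> simp [hi]
      omega
    rw [← h, ← one_mul (1 : k), ← monomial_mul]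
    exact Ideal.mul_mem_left _ _
      (Ideal.subset_span ⟨α.support, hα, (prod_X_eq_monomial _).symm⟩)

lemma linkIdeal_eq : linkIdeal k D σ = monIdeal k (NonLink D σ) NonLink.add := by
  have mem (f : MvPolynomial (Fin n) k) :
      f ∈ linkIdeal k D σ ↔ f * monomial (indExp σ) 1 ∈ srIdeal k D := by
    rw [linkIdeal, xFace, prod_X_eq_monomial, Ideal.span, Submodule.colon_span,
      Submodule.mem_colon_singleton, smul_eq_mul]
  apply le_antisymm
  · intro f hf α hα
    rw [mem, srIdeal_eq] at hf
    have := hf (α + indExp σ) (by rwa [NonFace, support_exp_add, support_indExp])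
    rwa [coeff_mul_monomial, mul_one] at this
  · refine monIdeal_le fun α hα => ?_
    rw [mem, monomial_mul, srIdeal_eq, one_mul, monomial_mem_monIdeal, NonFace,
      support_exp_add, support_indExp]
    exact hα

lemma extI_le {P : (Fin n →₀ ℕ) → Prop} {hP} {K : Ideal (MvPolynomial (Fin (n + 1)) k)}
    (h : ∀ α, P α → monomial (consExp 0 α) 1 ∈ K) : extI k (monIdeal k P hP) ≤ K := by
  rw [extI, Ideal.map_le_iff_le_comap]
  refine monIdeal_le fun α hα => ?_
  rw [Ideal.mem_comap]
  have := h α hα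
  rwa [← Tv_pow_mul_toT, pow_zero, one_mul] at this

lemma TmulI_le {P : (Fin n →₀ ℕ) → Prop} {hP} {K : Ideal (MvPolynomial (Fin (n + 1)) k)}
    (h : ∀ α, P α → monomial (consExp 1 α) 1 ∈ K) : TmulI k (monIdeal k P hP) ≤ K := by
  have hle : monIdeal k P hP ≤ (Submodule.colon K {Tv k n}).comap (toT k) := by
    refine monIdeal_le fun α hα => ?_
    rw [Ideal.mem_comap, Submodule.mem_colon_singleton, smul_eq_mul, mul_comm]
    have := h α hα
    rwa [← Tv_pow_mul_toT, pow_one] at this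
  rw [TmulI, Ideal.span_le]
  rintro _ ⟨f, hf, rfl⟩
  have := hle hf
  rwa [Ideal.mem_comap, Submodule.mem_colon_singleton, smul_eq_mul, mul_comm] at this

lemma monomial_mem_of_base {P : (Fin n →₀ ℕ) → Prop} {hP}
    {K : Ideal (MvPolynomial (Fin (n + 1)) k)} (hK : extI k (monIdeal k P hP) ≤ K)
    {μ : Fin (n + 1) →₀ ℕ} (h : P (baseExp μ)) : monomial μ 1 ∈ K := by
  rw [← consExp_baseExp μ, ← Tv_pow_mul_toT]
  exact K.mul_mem_left _ (hK (Ideal.mem_map_of_mem _ (monomial_mem_monIdeal.2 h)))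

lemma monomial_mem_of_Tmul {P : (Fin n →₀ ℕ) → Prop} {hP}
    {K : Ideal (MvPolynomial (Fin (n + 1)) k)} (hK : TmulI k (monIdeal k P hP) ≤ K)
    {μ : Fin (n + 1) →₀ ℕ} (h0 : μ (Fin.last n) ≠ 0) (h : P (baseExp μ)) :
    monomial μ 1 ∈ K := by
  obtain ⟨t, ht⟩ := Nat.exists_eq_succ_of_ne_zero h0
  rw [← consExp_baseExp μ, ← Tv_pow_mul_toT, ht, pow_succ, mul_assoc]
  exact K.mul_mem_left _ (hK (Ideal.subset_span ⟨_, monomial_mem_monIdeal.2 h, rfl⟩))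

lemma monomial_mem_of_last {K : Ideal (MvPolynomial (Fin (n + 1)) k)} {t : ℕ}
    (hK : Tv k n ^ t ∈ K) {μ : Fin (n + 1) →₀ ℕ} (h : t ≤ μ (Fin.last n)) :
    monomial μ 1 ∈ K := by
  rw [← consExp_baseExp μ, ← Tv_pow_mul_toT, ← Nat.add_sub_of_le h, pow_add, mul_assoc]
  exact K.mul_mem_right _ hK

lemma IC_eq : IC k D σ q = monIdeal k (NonC D σ q) NonC.add := by
  rw [IC, srIdeal_eq, linkIdeal_eq]
  apply le_antisymm
  · refine sup_le (sup_le (extI_le fun α hα => ?_) ?_) (TmulI_le fun α hα => ?_)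
    · exact monomial_mem_monIdeal.2 (.inl (by rwa [baseExp_consExp]))
    · rw [Ideal.span_singleton_le_iff_mem, Tv_pow_eq_monomial, monomial_mem_monIdeal]
      exact .inr (.inl (by simp))
    · exact monomial_mem_monIdeal.2 (.inr (.inr ⟨by simp, by rwa [baseExp_consExp]⟩))
  · refine monIdeal_le fun μ hμ => ?_
    rcases hμ with h | h | ⟨h, h'⟩
    · exact monomial_mem_of_base (le_sup_left.trans le_sup_left) h
    · exact monomial_mem_of_last (t := q + 1) (Ideal.mem_sup_left
        (Ideal.mem_sup_right (Ideal.mem_span_singleton_self _))) h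
    · exact monomial_mem_of_Tmul le_sup_right h h'

lemma Jst_eq : Jst k D σ = monIdeal k (NonSt D σ) NonSt.add := by
  rw [Jst, srIdeal_eq, linkIdeal_eq, xFace, prod_X_eq_monomial, toT_monomial]
  apply le_antisymm
  · refine sup_le (sup_le (extI_le fun α hα => ?_) ?_) (TmulI_le fun α hα => ?_)
    · exact monomial_mem_monIdeal.2 (.inl (by rwa [baseExp_consExp]))
    · rw [Ideal.span_singleton_le_iff_mem, monomial_mem_monIdeal]
      refine .inr (.inl fun i hi => ?_)
      simp [hi]
    · exact monomial_mem_monIdeal.2 (.inr (.inr ⟨by simp, by rwa [baseExp_consExp]⟩))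
  · refine monIdeal_le fun μ hμ => ?_
    rcases hμ with h | h | ⟨h, h'⟩
    · exact monomial_mem_of_base (le_sup_left.trans le_sup_left) h
    · refine Ideal.mem_sup_left (Ideal.mem_sup_right ?_)
      have h1 : μ - upExp (indExp σ) + upExp (indExp σ) = μ := by
        refine exp_ext (fun i => ?_) (by simp)
        by_cases hi : i ∈ σ
        · have := h hi
          simp [hi] at this ⊢
          omega
        · simp [hi]
      have h2 : (monomial μ 1 : MvPolynomial _ k) =
          monomial (μ - upExp (indExp σ)) 1 * monomial (upExp (indExp σ)) 1 := by
        rw [monomial_mul, h1, one_mul]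
      rw [h2]
      exact Ideal.mul_mem_left _ _ (Ideal.mem_span_singleton_self _)
    · exact monomial_mem_of_Tmul le_sup_right h h'

end Ideals

/-! ### Normal forms and the Hilbert function -/

/-- The linear map with prescribed values on monomials. -/
def linOf {ι M : Type} [AddCommGroup M] [Module k M] (w : (ι →₀ ℕ) → M) :
    MvPolynomial ι k →ₗ[k] M :=
  (basisMonomials ι k).constr k w

section LinOf

variable {k} {ι κ M : Type} [AddCommGroup M] [Module k M]

lemma linOf_monomial (w : (ι →₀ ℕ) → M) (μ : ι →₀ ℕ) (c : k) :
    linOf k w (monomial μ c) = c • w μ := by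
  have h : linOf k w (monomial μ 1) = w μ := by
    have := (basisMonomials ι k).constr_basis k w μ
    rwa [coe_basisMonomials] at this
  rw [← h, ← map_smul, smul_monomial, smul_eq_mul, mul_one]

lemma linOf_apply (w : (ι →₀ ℕ) → M) (f : MvPolynomial ι k) :
    linOf k w f = ∑ μ ∈ f.support, coeff μ f • w μ := by
  conv_lhs => rw [f.as_sum, map_sum]
  exact Finset.sum_congr rfl fun μ _ => linOf_monomial _ _ _

lemma linOf_mem {w : (ι →₀ ℕ) → MvPolynomial κ k} {K : Ideal (MvPolynomial κ k)}
    {f : MvPolynomial ι k} (h : ∀ μ ∈ f.support, w μ ∈ K) : linOf k w f ∈ K := by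
  rw [linOf_apply]
  refine Ideal.sum_mem _ fun μ hμ => ?_
  rw [← C_mul']
  exact K.mul_mem_left _ (h μ hμ)

end LinOf

/-- The exponent of the normal form of a monomial of `R[T]` modulo `T ^ (q + 1) - x_σ`. -/
def nfExp {n : ℕ} (σ : Finset (Fin n)) (q : ℕ) (μ : Fin (n + 1) →₀ ℕ) : Fin (n + 1) →₀ ℕ :=
  consExp (μ (Fin.last n) % (q + 1))
    (baseExp μ + (μ (Fin.last n) / (q + 1)) • indExp σ)

section NormalForm

variable {k} {n q : ℕ} {D : SC n} {σ : Finset (Fin n)}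

lemma nfExp_last (μ : Fin (n + 1) →₀ ℕ) :
    nfExp σ q μ (Fin.last n) = μ (Fin.last n) % (q + 1) := by simp [nfExp]

lemma nfExp_castSucc (μ : Fin (n + 1) →₀ ℕ) (i : Fin n) :
    nfExp σ q μ i.castSucc =
      μ i.castSucc + μ (Fin.last n) / (q + 1) * (if i ∈ σ then 1 else 0) := by
  simp [nfExp]

lemma degree_nfExp (hcard : σ.card = q + 1) (μ : Fin (n + 1) →₀ ℕ) :
    (nfExp σ q μ).degree = μ.degree := by
  conv_rhs => rw [← consExp_baseExp μ]
  rw [nfExp, degree_consExp, degree_consExp, map_add, map_nsmul, degree_indExp, hcard,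
    smul_eq_mul]
  have := Nat.div_add_mod' (μ (Fin.last n)) (q + 1)
  omega

lemma nfExp_eq_self {μ : Fin (n + 1) →₀ ℕ} (h : μ (Fin.last n) ≤ q) : nfExp σ q μ = μ := by
  rw [nfExp, Nat.mod_eq_of_lt (Nat.lt_succ_of_le h), Nat.div_eq_of_lt (Nat.lt_succ_of_le h),
    zero_smul, add_zero, consExp_baseExp]

lemma support_base_subset_nfExp (μ : Fin (n + 1) →₀ ℕ) :
    (baseExp μ).support ⊆ (baseExp (nfExp σ q μ)).support := by
  rw [nfExp, baseExp_consExp, support_exp_add]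
  exact Finset.subset_union_left

lemma support_base_nfExp_subset (μ : Fin (n + 1) →₀ ℕ) :
    (baseExp (nfExp σ q μ)).support ⊆ (baseExp μ).support ∪ σ := by
  rw [nfExp, baseExp_consExp, support_exp_add]
  refine Finset.union_subset_union_right fun i hi => ?_
  by_contra h
  simp [h] at hi

lemma subset_support_base_nfExp {μ : Fin (n + 1) →₀ ℕ}
    (h : μ (Fin.last n) / (q + 1) ≠ 0) : σ ⊆ (baseExp (nfExp σ q μ)).support := by
  intro i hi
  rw [Finsupp.mem_support_iff, baseExp_apply, nfExp_castSucc, if_pos hi]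
  omega

lemma NonC_nfExp {μ : Fin (n + 1) →₀ ℕ}
    (h : NonFace D (baseExp μ) ∨ μ (Fin.last n) ≠ 0 ∧ NonLink D σ (baseExp μ)) :
    NonC D σ q (nfExp σ q μ) := by
  rcases h with h | ⟨h, h'⟩
  · exact .inl (D.notMem_mono (support_base_subset_nfExp μ) h)
  · by_cases hd : μ (Fin.last n) / (q + 1) = 0
    · refine .inr (.inr ⟨?_, D.notMem_mono
        (Finset.union_subset_union_left (support_base_subset_nfExp μ)) h'⟩)
      rw [nfExp_last]
      intro hm
      have := Nat.div_add_mod' (μ (Fin.last n)) (q + 1)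
      rw [hd, hm] at this
      omega
    · exact .inl (D.notMem_mono (Finset.union_subset (support_base_subset_nfExp μ)
        (subset_support_base_nfExp hd)) h')

lemma not_NonC_nfExp {μ : Fin (n + 1) →₀ ℕ} (h : ¬ NonSt D σ μ) :
    ¬ NonC D σ q (nfExp σ q μ) := by
  simp only [NonSt, NonFace, NonLink, not_or, not_and, not_not] at h
  obtain ⟨h1, -, h3⟩ := h
  have hlink (h0 : μ (Fin.last n) ≠ 0) : (baseExp (nfExp σ q μ)).support ∪ σ ∈ D.faces :=
    D.down_closed _ (h3 h0) _
      (Finset.union_subset (support_base_nfExp_subset μ) Finset.subset_union_right)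
  simp only [NonC, NonFace, NonLink, not_or, not_and, not_not]
  refine ⟨?_, ?_, ?_⟩
  · by_cases h0 : μ (Fin.last n) = 0
    · rwa [nfExp_eq_self (by omega)]
    · exact D.down_closed _ (hlink h0) _ Finset.subset_union_left
  · rw [nfExp_last]
    have : μ (Fin.last n) % (q + 1) < q + 1 := Nat.mod_lt _ (Nat.succ_pos q)
    omega
  · intro h0
    apply hlink
    rintro h
    rw [nfExp_last, h, Nat.zero_mod] at h0
    exact h0 rfl

lemma nfExp_injOn {μ ν : Fin (n + 1) →₀ ℕ} (hμ : ¬ σ ⊆ (baseExp μ).support)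
    (hν : ¬ σ ⊆ (baseExp ν).support) (h : nfExp σ q μ = nfExp σ q ν) : μ = ν := by
  have hi (i : Fin n) := DFunLike.congr_fun h i.castSucc
  have hl := DFunLike.congr_fun h (Fin.last n)
  simp only [nfExp_castSucc] at hi
  rw [nfExp_last, nfExp_last] at hl
  obtain ⟨i, hiσ, hi0⟩ := Finset.not_subset.1 hμ
  obtain ⟨j, hjσ, hj0⟩ := Finset.not_subset.1 hν
  rw [Finsupp.notMem_support_iff, baseExp_apply] at hi0 hj0
  have h1 := hi i
  have h2 := hi j
  rw [if_pos hiσ, hi0] at h1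
  rw [if_pos hjσ, hj0] at h2
  have hd : μ (Fin.last n) / (q + 1) = ν (Fin.last n) / (q + 1) := by omega
  refine exp_ext (fun l => ?_) ?_
  · have := hi l
    rw [hd] at this
    exact Nat.add_right_cancel this
  · rw [← Nat.div_add_mod (μ (Fin.last n)) (q + 1), hd, hl, Nat.div_add_mod]

lemma exists_nfExp_eq (hσ : σ.Nonempty) {ν : Fin (n + 1) →₀ ℕ} (h : ¬ NonC D σ q ν) :
    ∃ μ, ¬ NonSt D σ μ ∧ nfExp σ q μ = ν := by
  simp only [NonC, NonFace, NonLink, not_or, not_and, not_not, not_lt] at h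
  obtain ⟨h1, h2, h3⟩ := h
  obtain ⟨i, hi, hmin⟩ := Finset.exists_min_image σ (baseExp ν) hσ
  set a := baseExp ν i with ha
  set μ := consExp (ν (Fin.last n) + (q + 1) * a) (baseExp ν - a • indExp σ) with hμ
  have hmod : (ν (Fin.last n) + (q + 1) * a) % (q + 1) = ν (Fin.last n) := by
    rw [Nat.add_mul_mod_self_left, Nat.mod_eq_of_lt (by omega)]
  have hdiv : (ν (Fin.last n) + (q + 1) * a) / (q + 1) = a := by
    rw [Nat.add_mul_div_left _ _ (Nat.succ_pos q), Nat.div_eq_of_lt (by omega), zero_add]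
  have hsub : (baseExp μ).support ⊆ (baseExp ν).support := by
    intro j hj
    rw [Finsupp.mem_support_iff] at hj ⊢
    contrapose! hj
    rw [hμ, baseExp_consExp, Finsupp.tsub_apply, hj, zero_tsub]
  refine ⟨μ, ?_, ?_⟩
  · simp only [NonSt, NonFace, NonLink, not_or, not_and, not_not]
    refine ⟨D.down_closed _ h1 _ hsub, fun hc => ?_, fun h0 => ?_⟩
    · have := hc hi
      rw [Finsupp.mem_support_iff, hμ, baseExp_consExp] at this
      simp [hi, ← ha] at this
    · by_cases ht : ν (Fin.last n) = 0
      · refine D.down_closed _ h1 _ (Finset.union_subset hsub fun j hj => ?_)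
        have h4 := hmin j hj
        have h5 : a ≠ 0 := by
          rintro h5
          simp [hμ, ht, h5] at h0
        rw [Finsupp.mem_support_iff]
        omega
      · exact D.down_closed _ (h3 ht) _ (Finset.union_subset_union_left hsub)
  · refine exp_ext (fun j => ?_) ?_
    · rw [nfExp_castSucc, hμ, consExp_castSucc, consExp_last, hdiv]
      by_cases hj : j ∈ σ
      · have h4 := hmin j hj
        simp [hj] at h4 ⊢
        omega
      · simp [hj]
    · rw [nfExp_last, hμ, consExp_last, hmod]

lemma HFq_IC_eq (hcard : σ.card = q + 1) (m : ℕ) :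
    HFq k (IC k D σ q) m = HFq k (Jst k D σ) m := by
  rw [IC_eq, Jst_eq, HFq_monIdeal, HFq_monIdeal]
  symm
  refine Nat.card_eq_of_bijective (fun μ => ⟨nfExp σ q μ.1,
    (degree_nfExp hcard _).trans μ.2.1, not_NonC_nfExp μ.2.2⟩) ⟨?_, ?_⟩
  · rintro ⟨μ, hμ, hμ'⟩ ⟨ν, hν, hν'⟩ h
    simp only [NonSt, not_or] at hμ' hν'
    exact Subtype.ext (nfExp_injOn hμ'.2.1 hν'.2.1 (Subtype.ext_iff.1 h))
  · rintro ⟨ν, hν, hν'⟩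
    obtain ⟨μ, hμ, rfl⟩ := exists_nfExp_eq (Finset.card_pos.1 (by omega)) hν'
    exact ⟨⟨μ, (degree_nfExp hcard _).symm.trans hν, hμ⟩, rfl⟩

/-! ### The initial ideal -/

lemma linOf_nfExp_mem {f : MvPolynomial (Fin (n + 1)) k} (hf : f ∈ IG k D σ q) :
    linOf k (fun μ => monomial (nfExp σ q μ) (1 : k)) f ∈ IC k D σ q := by
  set N := linOf k (fun μ => monomial (nfExp σ q μ) (1 : k)) with hN
  let K : Ideal (MvPolynomial (Fin (n + 1)) k) :=
    { carrier := {f | ∀ p, N (p * f) ∈ IC k D σ q}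
      zero_mem' := by simp
      add_mem' := fun hf hg p => by
        rw [mul_add, map_add]; exact Ideal.add_mem _ (hf p) (hg p)
      smul_mem' := fun c f hf p => by
        rw [smul_eq_mul, ← mul_assoc]; exact hf _ }
  have hK {f : MvPolynomial (Fin (n + 1)) k}
      (h : ∀ μ, N (monomial μ 1 * f) ∈ IC k D σ q) : f ∈ K := by
    intro p
    rw [p.as_sum, Finset.sum_mul, map_sum]
    refine Ideal.sum_mem _ fun μ _ => ?_
    rw [← mul_one (coeff μ p), ← C_mul_monomial, mul_assoc, C_mul', map_smul, ← C_mul']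
    exact Ideal.mul_mem_left _ _ (h μ)
  have hmono {ν : Fin (n + 1) →₀ ℕ} (h : ∀ μ, NonC D σ q (nfExp σ q (μ + ν))) :
      monomial ν 1 ∈ K := by
    refine hK fun μ => ?_
    rw [monomial_mul, one_mul, hN, linOf_monomial, one_smul, IC_eq, monomial_mem_monIdeal]
    exact h μ
  have hle : IG k D σ q ≤ K := by
    rw [IG, srIdeal_eq, linkIdeal_eq]
    refine sup_le (sup_le (extI_le fun α hα => ?_) ?_) (TmulI_le fun α hα => ?_)
    · refine hmono fun μ => NonC_nfExp (.inl ?_)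
      rw [baseExp_add, baseExp_consExp]
      exact hα.add _ _
    · rw [Ideal.span_singleton_le_iff_mem, xFace, prod_X_eq_monomial, toT_monomial,
        Tv_pow_eq_monomial]
      refine hK fun μ => ?_
      rw [mul_sub, map_sub, monomial_mul, monomial_mul, one_mul, hN, linOf_monomial,
        linOf_monomial]
      have hnf : nfExp σ q (μ + consExp (q + 1) 0) = nfExp σ q (μ + upExp (indExp σ)) := by
        refine exp_ext (fun i => ?_) ?_
        · by_cases hi : i ∈ σ <;> simp [nfExp_castSucc, hi]
          ring
        · simp [nfExp_last]
      rw [hnf, sub_self]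
      exact Ideal.zero_mem _
    · refine hmono fun μ => NonC_nfExp (.inr ⟨by simp, ?_⟩)
      rw [baseExp_add, baseExp_consExp]
      exact hα.add _ _
  simpa using hle hf 1

lemma exists_revEnum_eq (i : Fin n) : ∃ j : Fin (n + 1), revEnum n j = i.castSucc ∧
    (j : ℕ) = n - 1 - i := by
  refine ⟨⟨n - 1 - i, by omega⟩, ?_, rfl⟩
  rw [revEnum, dif_pos (by have := i.2; simp; omega)]
  ext
  simp
  omega

lemma revEnum_cases (j : Fin (n + 1)) :
    (∃ i : Fin n, revEnum n j = i.castSucc ∧ (j : ℕ) = n - 1 - i) ∨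
      (revEnum n j = Fin.last n ∧ (j : ℕ) = n) := by
  rw [revEnum]
  split
  · exact .inl ⟨⟨n - 1 - j, by omega⟩, rfl, by simp; omega⟩
  · exact .inr ⟨rfl, by omega⟩

lemma revLexLT_of_face (hcard : σ.card = q + 1) :
    revLexLT (upExp (indExp σ)) (consExp (q + 1) 0) := by
  obtain ⟨i, hi, hmax⟩ := Finset.exists_max_image σ id (Finset.card_pos.1 (by omega))
  refine .inr ⟨?_, ?_⟩
  · have h : (upExp (indExp σ)).degree = (consExp (q + 1) (0 : Fin n →₀ ℕ)).degree := by
      have := degree_consExp 0 (indExp σ)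
      rw [consExp, Finsupp.single_zero, zero_add] at this
      rw [this, degree_consExp, degree_indExp, hcard]
      simp
    exact h
  · obtain ⟨j, hj, hj'⟩ := exists_revEnum_eq i
    refine ⟨j, by simp [hj, hi], fun l hl => ?_⟩
    rcases revEnum_cases l with ⟨i', hi', hl'⟩ | ⟨-, hl'⟩
    · rw [hi', upExp_castSucc, consExp_castSucc, indExp_apply, if_neg]
      · rfl
      · intro hc
        have h1 : (i' : ℕ) ≤ i := hmax i' hc
        have h2 : (l : ℕ) < j := hl
        omega
    · have h2 : (l : ℕ) < j := hl
      omega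

lemma not_revLexLT_nfExp (hcard : σ.card = q + 1) (ν : Fin (n + 1) →₀ ℕ)
    (hne : ν ≠ nfExp σ q ν) : ¬ revLexLT ν (nfExp σ q ν) := by
  have hd : expDeg (nfExp σ q ν) = expDeg ν := degree_nfExp hcard ν
  rintro (h | ⟨-, j, hj, hj'⟩)
  · omega
  · rcases revEnum_cases j with ⟨i, hi, -⟩ | ⟨-, hjn⟩
    · rw [hi, nfExp_castSucc] at hj
      omega
    · obtain ⟨i, hi⟩ := Finset.card_pos.1 (show 0 < σ.card by omega)
      obtain ⟨l, hl, hl'⟩ := exists_revEnum_eq i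
      have h1 := hj' l (Fin.lt_def.2 (by have := i.2; omega))
      rw [hl, nfExp_castSucc, if_pos hi] at h1
      have h2 : ν (Fin.last n) / (q + 1) = 0 := by omega
      refine hne (nfExp_eq_self ?_).symm
      rw [Nat.div_eq_zero_iff] at h2
      omega

lemma IC_eq_initIdeal (hcard : σ.card = q + 1) :
    IC k D σ q = initIdeal k (IG k D σ q) := by
  classical
  apply le_antisymm
  · have hmono {μ : Fin (n + 1) →₀ ℕ} (h : monomial μ 1 ∈ IG k D σ q) :
        monomial μ 1 ∈ initIdeal k (IG k D σ q) := by
      refine Ideal.subset_span ⟨_, h, μ, by simp, rfl, fun ν hν hne => ?_⟩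
      simp [coeff_monomial, hne.symm] at hν
    rw [IC_eq]
    refine monIdeal_le fun μ hμ => ?_
    rcases hμ with h | h | ⟨h, h'⟩
    · refine hmono (monomial_mem_of_base (hP := NonFace.add) ?_ h)
      rw [← srIdeal_eq]
      exact le_sup_left.trans le_sup_left
    · refine monomial_mem_of_last (t := q + 1) ?_ h
      rw [Tv_pow_eq_monomial]
      have hne : upExp (indExp σ) ≠ consExp (q + 1) 0 := by
        intro hc
        have := DFunLike.congr_fun hc (Fin.last n)
        simp at this
      refine Ideal.subset_span ⟨_, Ideal.mem_sup_left (Ideal.mem_sup_right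
        (Ideal.mem_span_singleton_self _)), consExp (q + 1) 0, ?_, rfl, fun ν hν hν' => ?_⟩
      · rw [xFace, prod_X_eq_monomial, toT_monomial, Tv_pow_eq_monomial, mem_support_iff,
          coeff_sub, coeff_monomial, coeff_monomial, if_pos rfl, if_neg hne, sub_zero]
        exact one_ne_zero
      · rw [xFace, prod_X_eq_monomial, toT_monomial, Tv_pow_eq_monomial, mem_support_iff,
          coeff_sub, coeff_monomial, coeff_monomial, if_neg hν'.symm] at hν
        have : upExp (indExp σ) = ν := by
          by_contra hc
          simp [hc] at hν
        rw [← this]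
        exact revLexLT_of_face hcard
    · refine hmono (monomial_mem_of_Tmul (hP := NonLink.add) ?_ h h')
      rw [← linkIdeal_eq]
      exact le_sup_right
  · rw [initIdeal, Ideal.span_le]
    rintro _ ⟨f, hf, μ, hμ, rfl, hlt⟩
    rw [SetLike.mem_coe, IC_eq, monomial_mem_monIdeal]
    by_contra hC
    have h1 := linOf_nfExp_mem hf
    rw [IC_eq] at h1
    have h2 := h1 μ hC
    rw [linOf_apply, coeff_sum, Finset.sum_eq_single μ] at h2
    · simp only [NonC, not_or, not_lt] at hC
      rw [nfExp_eq_self hC.2.1, coeff_smul, coeff_monomial, if_pos rfl, smul_eq_mul,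
        mul_one] at h2
      exact (mem_support_iff.1 hμ) h2
    · intro ν hν hne
      rw [coeff_smul, coeff_monomial, if_neg, smul_zero]
      rintro rfl
      exact not_revLexLT_nfExp hcard ν hne (hlt ν hν hne)
    · exact fun h => absurd hμ h

end NormalForm

/-! ### Cohen–Macaulayness -/

/-- The exponents of an embedding of `R[T] ⧸ I_C` into `k[D]` which is linear along
`x_i ↦ x_i ^ (q + 1)`. -/
def embExp {n : ℕ} (σ : Finset (Fin n)) (q : ℕ) (μ : Fin (n + 1) →₀ ℕ) : Fin n →₀ ℕ :=
  (q + 1) • baseExp μ + μ (Fin.last n) • indExp σ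

open Classical in
/-- The value on monomials of a retraction of the embedding given by `embExp`. -/
def retMon {n : ℕ} (σ : Finset (Fin n)) (q : ℕ) (γ : Fin n →₀ ℕ) :
    MvPolynomial (Fin (n + 1)) k :=
  if h : ∃ μ : Fin (n + 1) →₀ ℕ, μ (Fin.last n) ≤ q ∧ embExp σ q μ = γ then
    monomial h.choose 1 else 0

section Depth

variable {k} {n q : ℕ} {D : SC n} {σ : Finset (Fin n)}

lemma embExp_apply (μ : Fin (n + 1) →₀ ℕ) (i : Fin n) : embExp σ q μ i =
    (q + 1) * μ i.castSucc + μ (Fin.last n) * (if i ∈ σ then 1 else 0) := by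
  simp [embExp]

lemma embExp_add (α : Fin n →₀ ℕ) (μ : Fin (n + 1) →₀ ℕ) :
    embExp σ q (upExp α + μ) = (q + 1) • α + embExp σ q μ := by
  ext i
  simp only [embExp_apply, Finsupp.add_apply, upExp_castSucc, upExp_last, Finsupp.smul_apply,
    smul_eq_mul]
  ring

lemma embExp_injOn (hσ : σ.Nonempty) {μ ν : Fin (n + 1) →₀ ℕ} (hμ : μ (Fin.last n) ≤ q)
    (hν : ν (Fin.last n) ≤ q) (h : embExp σ q μ = embExp σ q ν) : μ = ν := by
  have hl : μ (Fin.last n) = ν (Fin.last n) := by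
    obtain ⟨i, hi⟩ := hσ
    have := congrArg (· % (q + 1)) (DFunLike.congr_fun h i)
    simp only [embExp_apply, if_pos hi, mul_one, Nat.mul_add_mod] at this
    rwa [Nat.mod_eq_of_lt (by omega), Nat.mod_eq_of_lt (by omega)] at this
  refine exp_ext (fun i => ?_) hl
  have := DFunLike.congr_fun h i
  rw [embExp_apply, embExp_apply, hl] at this
  exact Nat.eq_of_mul_eq_mul_left q.succ_pos (Nat.add_right_cancel this)

lemma exists_embExp_of_add {α γ : Fin n →₀ ℕ} {ν : Fin (n + 1) →₀ ℕ}
    (hν : ν (Fin.last n) ≤ q) (h : embExp σ q ν = (q + 1) • α + γ) :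
    ∃ μ : Fin (n + 1) →₀ ℕ, μ (Fin.last n) ≤ q ∧ embExp σ q μ = γ := by
  have hle (i : Fin n) : α i ≤ ν i.castSucc := by
    have := DFunLike.congr_fun h i
    simp only [embExp_apply, Finsupp.add_apply, Finsupp.smul_apply, smul_eq_mul] at this
    by_contra! hlt
    have h1 : (q + 1) * (ν i.castSucc + 1) ≤ (q + 1) * α i := Nat.mul_le_mul_left _ hlt
    have h2 : ν (Fin.last n) * (if i ∈ σ then 1 else 0) ≤ q := by split_ifs <;> omega
    rw [mul_add] at h1
    omega
  have hadd : upExp α + (ν - upExp α) = ν := exp_ext (fun i => by simp [hle]) (by simp)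
  refine ⟨ν - upExp α, by simpa using hν, ?_⟩
  rw [← hadd, embExp_add] at h
  exact add_left_cancel h

lemma retMon_embExp (hσ : σ.Nonempty) {μ : Fin (n + 1) →₀ ℕ} (hμ : μ (Fin.last n) ≤ q) :
    retMon k σ q (embExp σ q μ) = monomial μ 1 := by
  have h : ∃ ν : Fin (n + 1) →₀ ℕ, ν (Fin.last n) ≤ q ∧ embExp σ q ν = embExp σ q μ :=
    ⟨μ, hμ, rfl⟩
  rw [retMon, dif_pos h, embExp_injOn hσ h.choose_spec.1 hμ h.choose_spec.2]

lemma retMon_smul_add (hσ : σ.Nonempty) (α γ : Fin n →₀ ℕ) :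
    retMon k σ q ((q + 1) • α + γ) = toT k (monomial α 1) * retMon k σ q γ := by
  by_cases h : ∃ μ : Fin (n + 1) →₀ ℕ, μ (Fin.last n) ≤ q ∧ embExp σ q μ = γ
  · obtain ⟨μ, hμ, rfl⟩ := h
    rw [retMon_embExp hσ hμ, ← embExp_add, retMon_embExp hσ (by simpa using hμ), toT_monomial,
      monomial_mul, one_mul]
  · rw [retMon, retMon, dif_neg h, dif_neg, mul_zero]
    rintro ⟨ν, hν, hν'⟩
    exact h (exists_embExp_of_add hν hν')

lemma support_embExp {μ : Fin (n + 1) →₀ ℕ} : (embExp σ q μ).support =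
    (baseExp μ).support ∪ if μ (Fin.last n) = 0 then ∅ else σ := by
  ext i
  by_cases h : μ (Fin.last n) = 0 <;> simp [embExp_apply, h]
  tauto

lemma nonFace_embExp {μ : Fin (n + 1) →₀ ℕ} (hμ : μ (Fin.last n) ≤ q) :
    NonFace D (embExp σ q μ) ↔ NonC D σ q μ := by
  rw [NonFace, support_embExp, NonC, NonFace, NonLink]
  by_cases h : μ (Fin.last n) = 0
  · simp [h]
  · rw [if_neg h]
    refine ⟨fun h' => .inr (.inr ⟨h, h'⟩), ?_⟩
    rintro (h' | h' | h')
    · exact D.notMem_mono Finset.subset_union_left h'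
    · omega
    · exact h'.2

lemma map_mul_of_monomial {α β γ : Type} {a : MvPolynomial α k →ₐ[k] MvPolynomial β k}
    {b : MvPolynomial α k →ₐ[k] MvPolynomial γ k} {i : MvPolynomial β k →ₗ[k] MvPolynomial γ k}
    (h : ∀ u v, i (a (monomial u 1) * monomial v 1) = b (monomial u 1) * i (monomial v 1))
    (g : MvPolynomial α k) (z : MvPolynomial β k) : i (a g * z) = b g * i z := by
  induction g using MvPolynomial.induction_on' with
  | add p q hp hq => rw [map_add, map_add, add_mul, add_mul, map_add, hp, hq]
  | monomial u c =>
    induction z using MvPolynomial.induction_on' with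
    | add p q hp hq => rw [map_add, mul_add, mul_add, map_add, hp, hq]
    | monomial v e =>
      have hu : (monomial u c : MvPolynomial α k) = c • monomial u 1 := by simp [smul_monomial]
      have hv : (monomial v e : MvPolynomial β k) = e • monomial v 1 := by simp [smul_monomial]
      rw [hu, hv, map_smul, map_smul, map_smul, smul_mul_smul_comm, smul_mul_smul_comm, map_smul,
        h]

lemma regOn_IC (hσ : σ.Nonempty) {gs : List (MvPolynomial (Fin n) k)}
    (h : RegOn (srIdeal k D) (gs.map (expand (q + 1)).toRingHom)) :
    RegOn (IC k D σ q) (gs.map (toT k).toRingHom) := by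
  set i : MvPolynomial (Fin (n + 1)) k →ₗ[k] MvPolynomial (Fin n) k :=
    linOf k fun μ => if μ (Fin.last n) ≤ q then monomial (embExp σ q μ) 1 else 0 with hi
  set r : MvPolynomial (Fin n) k →ₗ[k] MvPolynomial (Fin (n + 1)) k :=
    linOf k (retMon k σ q) with hr
  have himul : ∀ g z, i (toT k g * z) = expand (q + 1) g * i z := by
    refine map_mul_of_monomial fun α μ => ?_
    rw [toT_monomial, monomial_mul, one_mul, hi, linOf_monomial, linOf_monomial, one_smul,
      one_smul, expand_monomial]
    simp only [Finsupp.add_apply, upExp_last, zero_add, embExp_add]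
    split_ifs
    · rw [monomial_mul, one_mul]
    · rw [mul_zero]
  have hrmul : ∀ g y, r (expand (q + 1) g * y) = toT k g * r y := by
    refine map_mul_of_monomial fun α γ => ?_
    rw [expand_monomial, monomial_mul, one_mul, hr, linOf_monomial, linOf_monomial, one_smul,
      one_smul, retMon_smul_add hσ]
  rw [IC_eq]
  rw [srIdeal_eq] at h
  refine RegOn.of_retract _ _ i.toAddMonoidHom r.toAddMonoidHom himul hrmul gs _ _
    (fun z hz => ?_) (fun y hy => ?_) (fun z => ?_) h
  · refine linOf_mem fun μ hμ => ?_
    split_ifs with hq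
    · rw [monomial_mem_monIdeal, nonFace_embExp hq]
      by_contra hc
      exact mem_support_iff.1 hμ (hz μ hc)
    · exact Ideal.zero_mem _
  · refine linOf_mem fun γ hγ => ?_
    by_cases h' : ∃ μ : Fin (n + 1) →₀ ℕ, μ (Fin.last n) ≤ q ∧ embExp σ q μ = γ
    · obtain ⟨μ, hμ, rfl⟩ := h'
      rw [retMon_embExp hσ hμ, monomial_mem_monIdeal, ← nonFace_embExp hμ]
      by_contra hc
      exact mem_support_iff.1 hγ (hy _ hc)
    · rw [retMon, dif_neg h']
      exact Ideal.zero_mem _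
  · change (r ∘ₗ i - (LinearMap.id : MvPolynomial (Fin (n + 1)) k →ₗ[k] _)) z ∈ _
    rw [z.as_sum, map_sum]
    refine Ideal.sum_mem _ fun μ _ => ?_
    rw [← mul_one (coeff μ z), ← C_mul_monomial, C_mul', map_smul, ← C_mul']
    refine Ideal.mul_mem_left _ _ ?_
    rw [LinearMap.sub_apply, LinearMap.comp_apply, hi, linOf_monomial, one_smul,
      LinearMap.id_apply]
    split_ifs with hq
    · rw [hr, linOf_monomial, one_smul, retMon_embExp hσ hq, sub_self]
      exact Ideal.zero_mem _
    · rw [map_zero, zero_sub, neg_mem_iff, monomial_mem_monIdeal]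
      exact .inr (.inl (by omega))

lemma span_X_le_ker (ι : Type) : Ideal.span (Set.range (X : ι → MvPolynomial ι k)) ≤
    RingHom.ker (constantCoeff : MvPolynomial ι k →+* k) := by
  rw [Ideal.span_le]
  rintro _ ⟨i, rfl⟩
  simp

lemma depthGE_of_regOn {κ : Type} {J : Ideal (MvPolynomial κ k)}
    (hJ : J ≤ RingHom.ker (constantCoeff : MvPolynomial κ k →+* k))
    {rs : List (MvPolynomial κ k)}
    (hm : ∀ f ∈ rs, f ∈ Ideal.span (Set.range (X : κ → MvPolynomial κ k)))
    (h : RegOn J rs) : depthGE k J rs.length := by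
  refine ⟨rs, rfl, hm, (isWeaklyRegular_map_mk_iff J rs).2 h, fun htop => ?_⟩
  have h1 : (Ideal.Quotient.mk J 1) ∈ Ideal.ofList (rs.map (Ideal.Quotient.mk J)) := by
    have : (Ideal.Quotient.mk J 1) ∈ (⊤ : Ideal (MvPolynomial κ k ⧸ J)) := trivial
    rwa [htop, smul_eq_mul, Ideal.mul_top] at this
  rw [← Ideal.map_ofList, Ideal.mem_quotient_iff_mem_sup] at h1
  have hle : Ideal.ofList rs ⊔ J ≤ RingHom.ker (constantCoeff : MvPolynomial κ k →+* k) :=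
    sup_le (Ideal.span_le.2 fun f hf => span_X_le_ker κ (hm f hf)) hJ
  simpa using hle h1

lemma IC_le_ker (hσ : σ ∈ D.faces) :
    IC k D σ q ≤ RingHom.ker (constantCoeff : MvPolynomial (Fin (n + 1)) k →+* k) := by
  intro f hf
  rw [IC_eq] at hf
  refine hf 0 ?_
  have : (baseExp (0 : Fin (n + 1) →₀ ℕ)).support = ∅ := by ext; simp
  simp [NonC, NonFace, this, D.down_closed σ hσ ∅ (by simp)]

lemma depthGE_IC {d : ℕ} (hσ : σ ∈ D.faces) (hne : σ.Nonempty)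
    (h : depthGE k (srIdeal k D) d) : depthGE k (IC k D σ q) d := by
  obtain ⟨rs, hl, hm, hreg⟩ := h
  set m := Ideal.span (Set.range (X : Fin n → MvPolynomial (Fin n) k)) with hmdef
  let φ : MvPolynomial (Fin n) k →+* MvPolynomial (Fin n) k :=
    (expand (q + 1)).toRingHom
  have hφ (i : Fin n) : φ (X i) = X i ^ (q + 1) := expand_X _ _
  have h₁ : m.map φ ≤ m := by
    rw [hmdef, Ideal.map_span, Ideal.span_le]
    rintro _ ⟨_, ⟨i, rfl⟩, rfl⟩
    rw [hφ]
    exact Ideal.pow_mem_of_mem _ (Ideal.subset_span (Set.mem_range_self i)) _ q.succ_pos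
  have h₂ : m ≤ (m.map φ).radical := by
    conv_lhs => rw [hmdef]
    rw [Ideal.span_le]
    rintro _ ⟨i, rfl⟩
    refine ⟨q + 1, ?_⟩
    rw [← hφ]
    exact Ideal.mem_map_of_mem _ (Ideal.subset_span ⟨i, rfl⟩)
  obtain ⟨gs, hgl, hgm, hg⟩ := HasReg.exists_map φ h₁ h₂ d (srIdeal k D)
    ⟨rs, hl, hm, (isWeaklyRegular_map_mk_iff _ _).1 hreg.toIsWeaklyRegular⟩
  have := depthGE_of_regOn (IC_le_ker hσ) (fun f hf => ?_) (regOn_IC hne hg)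
  · rwa [List.length_map, hgl] at this
  · obtain ⟨g, hg', rfl⟩ := List.mem_map.1 hf
    have hle : m ≤ (Ideal.span (Set.range (X : Fin (n + 1) → MvPolynomial (Fin (n + 1)) k))).comap
        (toT k).toRingHom := by
      rw [hmdef, Ideal.span_le]
      rintro _ ⟨i, rfl⟩
      refine Ideal.subset_span ⟨i.castSucc, ?_⟩
      exact (rename_X _ _).symm
    exact hle (hgm g hg')

end Depth

section KrullDimension

variable {k} {n q : ℕ} {D : SC n} {σ : Finset (Fin n)}

/-- The retraction `R[T] → R` sending `T` to `0`. -/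
def evalTZero (k : Type) [Field k] (n : ℕ) :
    MvPolynomial (Fin (n + 1)) k →ₐ[k] MvPolynomial (Fin n) k :=
  aeval (Fin.lastCases 0 X)

lemma evalTZero_toT (f : MvPolynomial (Fin n) k) : evalTZero k n (toT k f) = f := by
  have : (evalTZero k n).comp (toT k) = AlgHom.id k _ :=
    algHom_ext fun i => by simp [evalTZero, toT]
  exact DFunLike.congr_fun this f

lemma evalTZero_Tv : evalTZero k n (Tv k n) = 0 := by
  simp [evalTZero, Tv]

lemma sub_toT_evalTZero_mem (f : MvPolynomial (Fin (n + 1)) k) :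
    f - toT k (evalTZero k n f) ∈ Ideal.span {Tv k n} := by
  rw [← Ideal.Quotient.mk_eq_mk_iff_sub_mem]
  have : Ideal.Quotient.mkₐ k (Ideal.span {Tv k n}) =
      ((Ideal.Quotient.mkₐ k (Ideal.span {Tv k n})).comp (toT k)).comp (evalTZero k n) := by
    refine algHom_ext fun i => ?_
    refine Fin.lastCases ?_ (fun i => ?_) i
    · simp only [AlgHom.comp_apply]
      change Ideal.Quotient.mkₐ k _ (Tv k n) =
        Ideal.Quotient.mkₐ k _ (toT k (evalTZero k n (Tv k n)))
      rw [evalTZero_Tv, map_zero, map_zero]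
      exact Ideal.Quotient.eq_zero_iff_mem.2 (Ideal.mem_span_singleton_self _)
    · simp [evalTZero, toT]
  exact DFunLike.congr_fun this f

lemma ringKrullDim_IC :
    ringKrullDim (MvPolynomial (Fin (n + 1)) k ⧸ IC k D σ q) =
      ringKrullDim (MvPolynomial (Fin n) k ⧸ srIdeal k D) := by
  apply le_antisymm
  · have hz : PrimeSpectrum.zeroLocus (IC k D σ q : Set (MvPolynomial (Fin (n + 1)) k)) =
        PrimeSpectrum.zeroLocus
          ((IC k D σ q ⊔ Ideal.span {Tv k n} : Ideal _) : Set (MvPolynomial (Fin (n + 1)) k)) := by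
      ext p
      simp only [PrimeSpectrum.mem_zeroLocus, SetLike.coe_subset_coe, sup_le_iff,
        Ideal.span_singleton_le_iff_mem]
      refine ⟨fun h => ⟨h, p.2.mem_of_pow_mem (q + 1) (h ?_)⟩, And.left⟩
      exact Ideal.mem_sup_left (Ideal.mem_sup_right (Ideal.mem_span_singleton_self _))
    rw [ringKrullDim_quotient, hz, ← ringKrullDim_quotient]
    refine ringKrullDim_le_of_surjective
      (Ideal.quotientMap _ (toT k).toRingHom ?_) ?_
    · rw [← Ideal.map_le_iff_le_comap]
      exact le_sup_left.trans (le_sup_left.trans le_sup_left)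
    · intro y
      obtain ⟨f, rfl⟩ := Ideal.Quotient.mk_surjective y
      refine ⟨Ideal.Quotient.mk _ (evalTZero k n f), ?_⟩
      rw [Ideal.quotientMap_mk]
      symm
      rw [Ideal.Quotient.mk_eq_mk_iff_sub_mem]
      exact Ideal.mem_sup_right (sub_toT_evalTZero_mem f)
  · refine ringKrullDim_le_of_surjective
      (Ideal.quotientMap _ (evalTZero k n).toRingHom ?_) ?_
    · refine sup_le (sup_le ?_ ?_) ?_
      · rw [extI, Ideal.map_le_iff_le_comap]
        intro f hf
        rw [Ideal.mem_comap, Ideal.mem_comap]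
        change evalTZero k n (toT k f) ∈ _
        rwa [evalTZero_toT]
      · rw [Ideal.span_singleton_le_iff_mem, Ideal.mem_comap]
        change evalTZero k n _ ∈ _
        rw [map_pow, evalTZero_Tv, zero_pow q.succ_ne_zero]
        exact Ideal.zero_mem _
      · rw [TmulI, Ideal.span_le]
        rintro _ ⟨f, -, rfl⟩
        change evalTZero k n _ ∈ srIdeal k D
        rw [map_mul, evalTZero_Tv, zero_mul]
        exact Ideal.zero_mem _
    · intro y
      obtain ⟨f, rfl⟩ := Ideal.Quotient.mk_surjective y
      exact ⟨Ideal.Quotient.mk _ (toT k f), congrArg (Ideal.Quotient.mk _) (evalTZero_toT f)⟩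

end KrullDimension

/-- **Lemma.** `R[T]/I_C` is Cohen–Macaulay of Krull dimension `d` with
`HF(R[T]/I_C) = HF(k[D_σ])`, and `I_C` is the initial ideal of `I_G` with respect to
the reverse lexicographic order with `T > x₁ > … > xₙ`. -/
theorem structure_of_IC (k : Type) [Field k] [Infinite k]
    (n q d : ℕ) (hq : 1 ≤ q)
    (D : SC n) (hD : gorStar k D)
    (σ : Finset (Fin n)) (hσ : σ ∈ D.faces) (hcard : σ.card = q + 1)
    (hd : d = dimP D) :
    isCM k (IC k D σ q) d ∧
    (∀ m : ℕ, HFq k (IC k D σ q) m = HFq k (Jst k D σ) m) ∧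
    IC k D σ q = initIdeal k (IG k D σ q) := by
  have hne : σ.Nonempty := Finset.card_pos.1 (by omega)
  refine ⟨⟨?_, ?_⟩, HFq_IC_eq hcard, IC_eq_initIdeal hcard⟩
  · rw [ringKrullDim_IC, hd]
    exact hD.2.1.1.1
  · rw [hd]
    exact depthGE_IC hσ hne hD.2.1.1.2

end SRWLP
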